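/- arXiv:2603.09076 — 2 statements merged into one kernel-verified Lean document; each statement's English description precedes it below -/
import Mathlib

section
/- Let f : ℝⁿ × ℝ → ℝⁿ, h : ℝⁿ → ℝᵖ and β : ℝᵖ × ℝ → ℝ^{n_z}, and let φ : ℝⁿ × ℝ → ℝ^{n_z} be continuously differentiable and satisfy, for all (x,t), the partial differential equation ∂φ/∂t(x,t) + (D_x φ)(x,t)[f(x,t)] = β(h(x),t), where D_x φ denotes the Fréchet derivative of φ with respect to x. Let x : ℝ → ℝⁿ be differentiable with ẋ(t) = f(x(t),t), and let ζ : ℝ → ℝ^{n_z} be differentiable with ζ̇(t) = β(h(x(t)),t). Then the function t ↦ φ(x(t),t) − ζ(t) is constant; equivalently, there exists a constant vector θ ∈ ℝ^{n_z} such that φ(x(t),t) = ζ(t) + θ for all t. -/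
/-- The total derivative of a differentiable function of two variables along a curve, expressed
through its partial derivatives. -/
theorem hasDerivAt_along_curve_of_partials {E F : Type*}
    [NormedAddCommGroup E] [NormedSpace ℝ E] [NormedAddCommGroup F] [NormedSpace ℝ F]
    {g : E → ℝ → F} {x : ℝ → E} {t : ℝ} {gt : F} {gx : E →L[ℝ] F} {v : E}
    (hg : DifferentiableAt ℝ (fun q : E × ℝ => g q.1 q.2) (x t, t))
    (hgt : HasDerivAt (fun τ => g (x t) τ) gt t)
    (hgx : HasFDerivAt (fun ξ => g ξ t) gx (x t))
    (hx : HasDerivAt x v t) :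
    HasDerivAt (fun τ => g (x τ) τ) (gt + gx v) t := by
  have hD := hg.hasFDerivAt
  set D := fderiv ℝ (fun q : E × ℝ => g q.1 q.2) (x t, t)
  have htime : D (0, 1) = gt :=
    HasDerivAt.unique (hD.comp_hasDerivAt (f := fun τ => (x t, τ)) t
      ((hasDerivAt_const t (x t)).prodMk (hasDerivAt_id t))) hgt
  have hspace : D.comp (.inl ℝ E ℝ) = gx :=
    HasFDerivAt.unique (hD.comp (f := fun ξ => (ξ, t)) (x t) (hasFDerivAt_prodMk_left (x t) t)) hgx
  have hsplit : D (v, 1) = gt + gx v := by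
    rw [← htime, ← hspace, ContinuousLinearMap.comp_apply, ContinuousLinearMap.inl_apply,
      ← map_add]
    simp
  rw [← hsplit]
  exact hD.comp_hasDerivAt (f := fun τ => (x τ, τ)) t (hx.prodMk (hasDerivAt_id t))


/-- the foundational PEBO invariance relation.

If `φ` is `C¹` and solves the PDE `∂φ/∂t + (D_x φ)[f] = β(h(x), t)`, `x(·)` is a
trajectory of `ẋ = f(x,t)`, and `ζ(·)` solves the dynamic extension `ζ̇ = β(h(x(t)), t)`,
then `t ↦ φ(x(t), t) − ζ(t)` is constant; i.e. there is a constant vector `θ` with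
`φ(x(t), t) = ζ(t) + θ` for all `t`. -/
theorem pebo_invariant_foliation
    (n p nz : ℕ)
    (f : (Fin n → ℝ) → ℝ → (Fin n → ℝ))
    (h : (Fin n → ℝ) → (Fin p → ℝ))
    (β : (Fin p → ℝ) → ℝ → (Fin nz → ℝ))
    (φ : (Fin n → ℝ) → ℝ → (Fin nz → ℝ))
    (hφ : ContDiff ℝ 1 fun q : (Fin n → ℝ) × ℝ => φ q.1 q.2)
    -- the partial derivatives of `φ`
    (φt : (Fin n → ℝ) → ℝ → (Fin nz → ℝ))
    (φx : (Fin n → ℝ) → ℝ → ((Fin n → ℝ) →L[ℝ] (Fin nz → ℝ)))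
    (hφt : ∀ x t, HasDerivAt (fun τ => φ x τ) (φt x t) t)
    (hφx : ∀ x t, HasFDerivAt (fun ξ => φ ξ t) (φx x t) x)
    -- `φ` solves the PDE `∂φ/∂t + (D_x φ)[f(x,t)] = β(h(x), t)`
    (hpde : ∀ x t, φt x t + φx x t (f x t) = β (h x) t)
    -- a trajectory of the system
    (x : ℝ → (Fin n → ℝ))
    (hx : ∀ t, HasDerivAt x (f (x t) t) t)
    -- the dynamic extension `ζ̇ = β(y, t)` with `y = h(x)`
    (ζ : ℝ → (Fin nz → ℝ))
    (hζ : ∀ t, HasDerivAt ζ (β (h (x t)) t) t) :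
    (∀ t₁ t₂ : ℝ, φ (x t₁) t₁ - ζ t₁ = φ (x t₂) t₂ - ζ t₂) ∧
      ∃ θ : Fin nz → ℝ, ∀ t : ℝ, φ (x t) t = ζ t + θ := by
  have hderiv (t : ℝ) : HasDerivAt (fun τ => φ (x τ) τ - ζ τ) 0 t := by
    have hφ_curve := hasDerivAt_along_curve_of_partials
      (hφ.differentiable one_ne_zero (x t, t)) (hφt (x t) t) (hφx (x t) t) (hx t)
    rw [hpde] at hφ_curve
    exact sub_self (β (h (x t)) t) ▸ hφ_curve.sub (hζ t)
  have hconst : ∀ t₁ t₂ : ℝ, φ (x t₁) t₁ - ζ t₁ = φ (x t₂) t₂ - ζ t₂ :=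
    is_const_of_deriv_eq_zero (fun t => (hderiv t).differentiableAt) (fun t => (hderiv t).deriv)
  exact ⟨hconst, φ (x 0) 0 - ζ 0, fun t => by rw [← hconst t 0, add_sub_cancel]⟩
end

section
/- Consider the planar system ẋ₁ = −x₁, ẋ₂ = −x₂ + x₁² with output y = x₂ + x₁³, and define the 3×3 matrix P(t) with rows: row 1 = ( t eᵗ , eᵗ + t eᵗ − e^{2t} , (e^{3t} − eᵗ)/2 ); row 2 = ( e^{2t} − eᵗ , e^{2t} − eᵗ − t e^{2t} , e^{3t} − e^{2t} ); row 3 = ( (e^{3t} − eᵗ)/2 , (e^{3t} − eᵗ)/2 − e^{3t} + e^{2t} , t e^{3t} ). Then for every differentiable solution x(·) = (x₁(·), x₂(·)) of the system, the curve z(t) = P(t) · (x₂(t), x₁(t)², x₁(t)³)ᵀ is differentiable and satisfies ż₁(t) = eᵗ (x₂(t) + x₁(t)³), ż₂(t) = e^{2t} (x₂(t) + x₁(t)³), and ż₃(t) = e^{3t} (x₂(t) + x₁(t)³); that is, with A = diag(−1,−2,−3) and B = (1,1,1)ᵀ, the map φ(x,t) = P(t)(x₂, x₁², x₁³)ᵀ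 satisfies ż = exp(−At) B h(x) along every trajectory, where h(x) = x₂ + x₁³. -/
open Matrix Real

/-- Section VI example: the explicit map `φ(x,t) = P(t)(x₂, x₁², x₁³)ᵀ`
solves the PEBO PDE.

For the planar system `ẋ₁ = −x₁`, `ẋ₂ = −x₂ + x₁²` with output `y = x₂ + x₁³`, along any
solution the curve `z(t) = P(t)(x₂(t), x₁(t)², x₁(t)³)ᵀ` is differentiable with
`ż(t) = (eᵗ y(t), e^{2t} y(t), e^{3t} y(t))ᵀ = exp(−At) B h(x(t))` for
`A = diag(−1,−2,−3)`, `B = (1,1,1)ᵀ`. -/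
theorem example_system_pde_solution
    (P : ℝ → Matrix (Fin 3) (Fin 3) ℝ)
    (hP : ∀ t : ℝ, P t =
      !![t * exp t, exp t + t * exp t - exp (2 * t), (exp (3 * t) - exp t) / 2;
         exp (2 * t) - exp t, exp (2 * t) - exp t - t * exp (2 * t),
           exp (3 * t) - exp (2 * t);
         (exp (3 * t) - exp t) / 2, (exp (3 * t) - exp t) / 2 - exp (3 * t) + exp (2 * t),
           t * exp (3 * t)])
    (x₁ x₂ : ℝ → ℝ)
    (hx₁ : ∀ t, HasDerivAt x₁ (-x₁ t) t)
    (hx₂ : ∀ t, HasDerivAt x₂ (-x₂ t + x₁ t ^ 2) t)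
    (z : ℝ → Fin 3 → ℝ)
    (hz : ∀ t, z t = P t *ᵥ ![x₂ t, x₁ t ^ 2, x₁ t ^ 3]) :
    ∀ t : ℝ, HasDerivAt z
      ![exp t * (x₂ t + x₁ t ^ 3),
        exp (2 * t) * (x₂ t + x₁ t ^ 3),
        exp (3 * t) * (x₂ t + x₁ t ^ 3)] t := by
  intro t
  have hexp (c : ℝ) : HasDerivAt (fun s => exp (c * s)) (exp (c * t) * c) t := by
    simpa using ((hasDerivAt_id t).const_mul c).exp
  have hid := hasDerivAt_id' t
  have h1 := Real.hasDerivAt_exp t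
  have h2 := hexp 2
  have h3 := hexp 3
  have ha := (hx₁ t).fun_pow 2
  have hb := (hx₁ t).fun_pow 3
  have hz' : z = fun s => P s *ᵥ ![x₂ s, x₁ s ^ 2, x₁ s ^ 3] := funext hz
  rw [hz', hasDerivAt_pi]
  intro i
  fin_cases i <;> simp [hP, mulVec, dotProduct, Fin.sum_univ_three]
  · convert (((hid.fun_mul h1).fun_mul (hx₂ t)).fun_add
      (((h1.fun_add (hid.fun_mul h1)).fun_sub h2).fun_mul ha)).fun_add
      (((h3.fun_sub h1).div_const 2).fun_mul hb) using 1
    push_cast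
    ring
  · convert (((h2.fun_sub h1).fun_mul (hx₂ t)).fun_add
      (((h2.fun_sub h1).fun_sub (hid.fun_mul h2)).fun_mul ha)).fun_add
      ((h3.fun_sub h2).fun_mul hb) using 1
    push_cast
    ring
  · convert ((((h3.fun_sub h1).div_const 2).fun_mul (hx₂ t)).fun_add
      (((((h3.fun_sub h1).div_const 2).fun_sub h3).fun_add h2).fun_mul ha)).fun_add
      ((hid.fun_mul h3).fun_mul hb) using 1
    push_cast
    ring
end
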